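/- Let d ≥ 1, R = (R_1,…,R_d) with all R_j > 0, p = max{1/2, R_1,…,R_d}, g(R) = (1/R_1+…+1/R_d)^{-1}, and b_R = (Σ_{j=1}^d (1/2)^{2R_j})^{1/(2p)}. For m ∈ ℕ, m ≥ 1, let C(m,R,d) be the number of lattice points k ∈ ℤ^d with Σ_{j=1}^d |k_j|^{2R_j} ≤ m^{2p}. Then (max{m − b_R, 0})^{p/g(R)} · vol(B_{2R}^d) ≤ C(m,R,d) ≤ (m + b_R)^{p/g(R)} · vol(B_{2R}^d). -/

import Mathlib

open MeasureTheory

section AnisotropicBalls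

variable {ι : Type*}

/-- The half-open unit cube centred at the lattice point `k`. -/
def centredCube (k : ι → ℤ) : Set (ι → ℝ) :=
  Set.univ.pi fun j => Set.Ico ((k j : ℝ) - 1 / 2) ((k j : ℝ) + 1 / 2)

lemma mem_centredCube_iff {k : ι → ℤ} {x : ι → ℝ} :
    x ∈ centredCube k ↔ (fun j => round (x j)) = k := by
  simp only [centredCube, Set.mem_univ_pi, Set.mem_Ico, funext_iff, round_eq, Int.floor_eq_iff]
  refine forall_congr' fun j => ?_
  constructor <;> rintro ⟨h₁, h₂⟩ <;> constructor <;> linarith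

lemma pairwise_disjoint_centredCube : Pairwise (Function.onFun Disjoint (centredCube (ι := ι))) :=
  fun _ _ hkl => Set.disjoint_left.2 fun _ hk hl =>
    hkl ((mem_centredCube_iff.1 hk).symm.trans (mem_centredCube_iff.1 hl))

lemma abs_sub_le_of_mem_centredCube {k : ι → ℤ} {x : ι → ℝ} (h : x ∈ centredCube k) (j : ι) :
    |x j - k j| ≤ 1 / 2 := by
  rw [← mem_centredCube_iff.1 h]
  exact abs_sub_round (x j)

variable [Fintype ι]

/-- The anisotropic functional `x ↦ (∑ j, |x j| ^ (2 R j)) ^ (1 / (2 p))`. -/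
noncomputable def anisoNorm (R : ι → ℝ) (p : ℝ) (x : ι → ℝ) : ℝ :=
  (∑ j, |x j| ^ (2 * R j)) ^ (1 / (2 * p))

lemma sum_abs_rpow_nonneg (R : ι → ℝ) (x : ι → ℝ) : 0 ≤ ∑ j, |x j| ^ (2 * R j) :=
  Finset.sum_nonneg fun j _ => Real.rpow_nonneg (abs_nonneg (x j)) _

lemma anisoNorm_nonneg (R : ι → ℝ) (p : ℝ) (x : ι → ℝ) : 0 ≤ anisoNorm R p x :=
  Real.rpow_nonneg (sum_abs_rpow_nonneg R x) _

lemma anisoNorm_le_iff {R : ι → ℝ} {p : ℝ} (hp : 0 < p) {r : ℝ} (hr : 0 ≤ r) (x : ι → ℝ) :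
    anisoNorm R p x ≤ r ↔ ∑ j, |x j| ^ (2 * R j) ≤ r ^ (2 * p) := by
  rw [anisoNorm, one_div]
  exact Real.rpow_inv_le_iff_of_pos (sum_abs_rpow_nonneg R x) hr (by positivity)

lemma anisoNorm_le_add {R : ι → ℝ} {p : ℝ} (hR : ∀ j, 0 < R j) (hp : 1 / 2 ≤ p)
    (hRp : ∀ j, R j ≤ p) {x y z : ι → ℝ} (h : ∀ j, |z j| ≤ |x j| + |y j|) :
    anisoNorm R p z ≤ anisoNorm R p x + anisoNorm R p y := by
  have hp0 : 0 < p := by linarith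
  have key : ∀ w : ℝ, 0 ≤ w → ∀ j, (w ^ (R j / p)) ^ (2 * p) = w ^ (2 * R j) := by
    intro w hw j
    rw [← Real.rpow_mul hw]
    congr 1
    field_simp
  have mink := Real.Lp_add_le_of_nonneg (s := Finset.univ) (p := 2 * p)
    (f := fun j => |x j| ^ (R j / p)) (g := fun j => |y j| ^ (R j / p)) (by linarith)
    (fun j _ => by positivity) (fun j _ => by positivity)
  simp only [key _ (abs_nonneg _)] at mink
  refine le_trans ?_ mink
  refine Real.rpow_le_rpow (sum_abs_rpow_nonneg R z) (Finset.sum_le_sum fun j _ => ?_)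
    (by positivity)
  rw [← key _ (abs_nonneg (z j))]
  have hq : 0 ≤ R j / p := (div_pos (hR j) hp0).le
  refine Real.rpow_le_rpow (by positivity) ?_ (by positivity)
  calc |z j| ^ (R j / p) ≤ (|x j| + |y j|) ^ (R j / p) :=
        Real.rpow_le_rpow (abs_nonneg _) (h j) hq
    _ ≤ _ := Real.rpow_add_le_add_rpow (abs_nonneg _) (abs_nonneg _) hq
        ((div_le_one hp0).2 (hRp j))

lemma abs_le_rpow_of_sum_le {R : ι → ℝ} (hR : ∀ j, 0 < R j) {c : ℝ} {x : ι → ℝ}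
    (h : ∑ j, |x j| ^ (2 * R j) ≤ c) (j : ι) : |x j| ≤ c ^ (2 * R j)⁻¹ := by
  have hj : |x j| ^ (2 * R j) ≤ c :=
    (Finset.single_le_sum (f := fun j => |x j| ^ (2 * R j))
      (fun j _ => Real.rpow_nonneg (abs_nonneg (x j)) _) (Finset.mem_univ j)).trans h
  have := hR j
  exact (Real.le_rpow_inv_iff_of_pos (abs_nonneg _)
    ((sum_abs_rpow_nonneg R x).trans h) (by positivity)).2 hj

lemma volume_anisoBall_ne_top {R : ι → ℝ} (hR : ∀ j, 0 < R j) (c : ℝ) :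
    volume {x : ι → ℝ | ∑ j, |x j| ^ (2 * R j) ≤ c} ≠ ⊤ := by
  refine ne_top_of_le_ne_top (isCompact_univ_pi fun j =>
    isCompact_Icc (a := -(c ^ (2 * R j)⁻¹)) (b := c ^ (2 * R j)⁻¹)).measure_lt_top.ne
    (measure_mono fun x hx j _ => ?_)
  exact abs_le.1 (abs_le_rpow_of_sum_le hR hx j)

lemma finite_int_anisoBall {R : ι → ℝ} (hR : ∀ j, 0 < R j) (c : ℝ) :
    {k : ι → ℤ | ∑ j, |(k j : ℝ)| ^ (2 * R j) ≤ c}.Finite := by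
  refine (Set.Finite.pi' (t := fun j => Set.Icc (-⌈c ^ (2 * R j)⁻¹⌉) ⌈c ^ (2 * R j)⁻¹⌉)
    fun j => Set.finite_Icc _ _).subset fun k hk j => ?_
  have h := abs_le.1 (abs_le_rpow_of_sum_le hR (x := fun j => (k j : ℝ)) hk j)
  have hc := Int.le_ceil (c ^ (2 * R j)⁻¹)
  constructor
  · have : ((-⌈c ^ (2 * R j)⁻¹⌉ : ℤ) : ℝ) ≤ k j := by push_cast; linarith [h.1]
    exact_mod_cast this
  · exact_mod_cast h.2.trans hc

lemma volume_anisoBall {R : ι → ℝ} {p r : ℝ} (hR : ∀ j, 0 < R j) (hr : 0 < r) :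
    (volume {x : ι → ℝ | ∑ j, |x j| ^ (2 * R j) ≤ r ^ (2 * p)}).toReal
      = r ^ (p * ∑ j, 1 / R j) * (volume {x : ι → ℝ | ∑ j, |x j| ^ (2 * R j) ≤ 1}).toReal := by
  classical
  let f : (ι → ℝ) →ₗ[ℝ] (ι → ℝ) := Matrix.toLin' (Matrix.diagonal fun j => r ^ (-(p / R j)))
  have hdet : LinearMap.det f = (r ^ (p * ∑ j, 1 / R j))⁻¹ := by
    rw [LinearMap.det_toLin', Matrix.det_diagonal, ← Real.rpow_sum_of_pos hr,
      ← Real.rpow_neg hr.le, Finset.mul_sum, Finset.sum_neg_distrib]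
    simp only [mul_one_div]
  have hpos : 0 < r ^ (p * ∑ j, 1 / R j) := Real.rpow_pos_of_pos hr _
  have hpre : {x : ι → ℝ | ∑ j, |x j| ^ (2 * R j) ≤ r ^ (2 * p)}
      = f ⁻¹' {x : ι → ℝ | ∑ j, |x j| ^ (2 * R j) ≤ 1} := by
    ext x
    have hterm : ∀ j, |f x j| ^ (2 * R j) = |x j| ^ (2 * R j) / r ^ (2 * p) := by
      intro j
      have hRj := (hR j).ne'
      rw [Matrix.toLin'_apply, Matrix.mulVec_diagonal, abs_mul,
        abs_of_pos (Real.rpow_pos_of_pos hr _),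
        Real.mul_rpow (Real.rpow_nonneg hr.le _) (abs_nonneg _), ← Real.rpow_mul hr.le,
        show -(p / R j) * (2 * R j) = -(2 * p) by field_simp, Real.rpow_neg hr.le]
      ring
    simp only [Set.mem_ofPred_eq, Set.mem_preimage, hterm, ← Finset.sum_div]
    rw [div_le_one (Real.rpow_pos_of_pos hr _)]
  rw [hpre, Measure.addHaar_preimage_linearMap volume (by rw [hdet]; positivity), hdet, inv_inv,
    abs_of_pos hpos, ENNReal.toReal_mul, ENNReal.toReal_ofReal hpos.le]

lemma measurableSet_centredCube (k : ι → ℤ) : MeasurableSet (centredCube k) :=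
  MeasurableSet.univ_pi fun _ => measurableSet_Ico

lemma volume_centredCube (k : ι → ℤ) : volume (centredCube k) = 1 := by
  rw [centredCube, Real.volume_pi_Ico]
  refine Finset.prod_eq_one fun j _ => ?_
  rw [show (k j : ℝ) + 1 / 2 - ((k j : ℝ) - 1 / 2) = 1 by ring, ENNReal.ofReal_one]

lemma volume_biUnion_centredCube {S : Set (ι → ℤ)} (hS : S.Finite) :
    volume (⋃ k ∈ S, centredCube k) = S.ncard := by
  rw [measure_biUnion hS.countable (fun _ _ _ _ h => pairwise_disjoint_centredCube h)
    fun k _ => measurableSet_centredCube k]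
  simp only [volume_centredCube, ENNReal.tsum_one]
  rw [show ENat.card S = S.encard from rfl, ← hS.cast_ncard_eq]
  rfl

end AnisotropicBalls

/-- with `p = max{1/2, R_1,…,R_d}`, `g(R) = (Σ_j 1/R_j)⁻¹`,
`b_R = (Σ_j (1/2)^{2R_j})^{1/(2p)}` and
`C(m,R,d) = #{k ∈ ℤ^d : Σ_j |k_j|^{2R_j} ≤ m^{2p}}`, one has
`(max(m − b_R, 0))^{p/g(R)}·vol(B_{2R}^d) ≤ C(m,R,d) ≤ (m + b_R)^{p/g(R)}·vol(B_{2R}^d)`. -/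
theorem stmt_5 (d : ℕ) (hd : 1 ≤ d) (R : Fin d → ℝ) (hR : ∀ j, 0 < R j)
    (p : ℝ) (hp : IsGreatest (insert (1/2 : ℝ) (Set.range R)) p)
    (g : ℝ) (hg : g = (∑ j, 1 / R j)⁻¹)
    (b : ℝ) (hb : b = (∑ j, ((1 : ℝ) / 2) ^ (2 * R j)) ^ (1 / (2 * p)))
    (m : ℕ) (hm : 1 ≤ m) :
    max ((m : ℝ) - b) 0 ^ (p / g)
        * (volume {x : Fin d → ℝ | ∑ j, |x j| ^ (2 * R j) ≤ 1}).toReal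
      ≤ (Set.ncard {k : Fin d → ℤ |
          ∑ j, |(k j : ℝ)| ^ (2 * R j) ≤ (m : ℝ) ^ (2 * p)} : ℝ) ∧
    (Set.ncard {k : Fin d → ℤ |
          ∑ j, |(k j : ℝ)| ^ (2 * R j) ≤ (m : ℝ) ^ (2 * p)} : ℝ)
      ≤ ((m : ℝ) + b) ^ (p / g)
        * (volume {x : Fin d → ℝ | ∑ j, |x j| ^ (2 * R j) ≤ 1}).toReal := by
  have hp_half : 1 / 2 ≤ p := hp.2 (Set.mem_insert _ _)
  have hRp : ∀ j, R j ≤ p := fun j => hp.2 (Set.mem_insert_of_mem _ ⟨j, rfl⟩)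
  have hp0 : 0 < p := by linarith
  have hpg : p / g = p * ∑ j, 1 / R j := by rw [hg, div_inv_eq_mul]
  have hsum : 0 < ∑ j, 1 / R j :=
    Finset.sum_pos (fun j _ => one_div_pos.2 (hR j)) ⟨⟨0, hd⟩, Finset.mem_univ _⟩
  have hb_norm : b = anisoNorm R p fun _ => 1 / 2 := by
    rw [hb, anisoNorm, abs_of_pos (by norm_num : (0 : ℝ) < 1 / 2)]
  have hb0 : 0 ≤ b := hb_norm ▸ anisoNorm_nonneg R p _
  have hm0 : (0 : ℝ) < m := by exact_mod_cast hm
  set S : Set (Fin d → ℤ) := {k | ∑ j, |(k j : ℝ)| ^ (2 * R j) ≤ (m : ℝ) ^ (2 * p)}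
  have hfin : S.Finite := finite_int_anisoBall hR _
  have hvol := volume_biUnion_centredCube hfin
  have hcard : (S.ncard : ℝ) = (volume (⋃ k ∈ S, centredCube k)).toReal := by
    rw [hvol, ENNReal.toReal_natCast]
  have hmem : ∀ k : Fin d → ℤ, k ∈ S ↔ anisoNorm R p (fun j => (k j : ℝ)) ≤ m :=
    fun k => (anisoNorm_le_iff hp0 hm0.le _).symm
  have habs_half : |(1 / 2 : ℝ)| = 1 / 2 := abs_of_pos (by norm_num)
  rw [hpg, hcard]
  constructor
  · rcases le_or_gt ((m : ℝ) - b) 0 with h | h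
    · rw [max_eq_right h, Real.zero_rpow (by positivity), zero_mul]
      exact ENNReal.toReal_nonneg
    · rw [max_eq_left h.le, ← volume_anisoBall hR h]
      refine ENNReal.toReal_mono (hvol ▸ ENNReal.natCast_ne_top _) (measure_mono fun x hx => ?_)
      have hx' : anisoNorm R p x ≤ m - b := (anisoNorm_le_iff hp0 h.le x).2 hx
      refine Set.mem_biUnion (x := fun j => round (x j)) ?_ (mem_centredCube_iff.2 rfl)
      rw [hmem]
      have := anisoNorm_le_add hR hp_half hRp (x := x) (y := fun _ => 1 / 2)
        (z := fun j => (round (x j) : ℝ)) fun j => by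
          rw [habs_half]
          have h₁ := abs_sub_round (x j)
          have h₂ := abs_sub_abs_le_abs_sub (round (x j) : ℝ) (x j)
          rw [abs_sub_comm] at h₂
          linarith
      linarith
  · have hmb : 0 < (m : ℝ) + b := by linarith
    rw [← volume_anisoBall hR hmb]
    refine ENNReal.toReal_mono (volume_anisoBall_ne_top hR _) (measure_mono fun x hx => ?_)
    obtain ⟨k, hk, hxk⟩ := Set.mem_iUnion₂.1 hx
    rw [hmem] at hk
    refine (anisoNorm_le_iff hp0 hmb.le x).1 ?_
    have := anisoNorm_le_add hR hp_half hRp (x := fun j => (k j : ℝ)) (y := fun _ => 1 / 2)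
      (z := x) fun j => by
        rw [habs_half]
        have h₁ := abs_sub_le_of_mem_centredCube hxk j
        have h₂ := abs_sub_abs_le_abs_sub (x j) (k j : ℝ)
        linarith
    linarith
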